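/- For the error Markov chain started at X_0 = 0, the tail probabilities are nondecreasing in time: for every k ∈ {0,1,...,n} and every t ≥ 0, P[X_{t+1} ≥ k] ≥ P[X_t ≥ k]. -/

import Mathlib

/-- The probability mass function of a `Binomial(m, p)` random variable at `k`. -/
noncomputable def binomPMF (m : ℕ) (p : ℝ) (k : ℕ) : ℝ :=
  (m.choose k : ℝ) * p ^ k * (1 - p) ^ (m - k)

/-- One-step transition probability of the error Markov chain on `{0, ..., n}`:
from state `x`, draw `Y ~ Binomial(n − x, p)` and move to `x + Y − min (x + Y) K`. -/
noncomputable def stepProb (n K : ℕ) (p : ℝ) (x y : ℕ) : ℝ :=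
  ∑ yv ∈ Finset.range (n - x + 1),
    if x + yv - min (x + yv) K = y then binomPMF (n - x) p yv else 0

/-- `m`-step transition probability of the error Markov chain. -/
noncomputable def iterProb (n K : ℕ) (p : ℝ) : ℕ → ℕ → ℕ → ℝ
  | 0 => fun x y => if x = y then 1 else 0
  | (m + 1) => fun x y =>
      ∑ z ∈ Finset.range (n + 1), stepProb n K p x z * iterProb n K p m z y

lemma binomPMF_zero_right (m : ℕ) (p : ℝ) : binomPMF (m + 1) p 0 = (1 - p) * binomPMF m p 0 := by
  simp [binomPMF, pow_succ, mul_comm]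

lemma binomPMF_succ_succ (m : ℕ) (p : ℝ) (j : ℕ) :
    binomPMF (m + 1) p (j + 1) = (1 - p) * binomPMF m p (j + 1) + p * binomPMF m p j := by
  unfold binomPMF
  rw [Nat.choose_succ_succ, Nat.add_sub_add_right]
  rcases Nat.lt_or_ge j m with h | h
  · obtain ⟨d, rfl⟩ := Nat.exists_eq_add_of_lt h
    have h1 : j + d + 1 - j = d + 1 := by omega
    have h2 : j + d + 1 - (j + 1) = d := by omega
    rw [h1, h2]
    push_cast
    ring
  · have h1 : m.choose (j + 1) = 0 := Nat.choose_eq_zero_of_lt (by omega)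
    rw [h1]
    push_cast
    ring

/-- Expectation of `h (x + Y)` with `Y ~ Binomial(m, p)`. -/
noncomputable def binomExp (p : ℝ) (h : ℕ → ℝ) (m x : ℕ) : ℝ :=
  ∑ j ∈ Finset.range (m + 1), binomPMF m p j * h (x + j)

lemma binomExp_succ (p : ℝ) (h : ℕ → ℝ) (m x : ℕ) :
    binomExp p h (m + 1) x = (1 - p) * binomExp p h m x + p * binomExp p h m (x + 1) := by
  have e : binomExp p h m x = ∑ j ∈ Finset.range (m + 1 + 1), binomPMF m p j * h (x + j) := by
    rw [Finset.sum_range_succ]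
    simp [binomExp, binomPMF]
  rw [e, Finset.sum_range_succ']
  unfold binomExp
  rw [Finset.sum_range_succ', mul_add, Finset.mul_sum, Finset.mul_sum, binomPMF_zero_right,
    add_right_comm, ← Finset.sum_add_distrib, mul_assoc]
  congr 1
  refine Finset.sum_congr rfl fun j _ => ?_
  rw [binomPMF_succ_succ, show x + 1 + j = x + (j + 1) by omega]
  ring

lemma binomPMF_nonneg (m : ℕ) (p : ℝ) (hp0 : 0 < p) (hp1 : p < 1) (j : ℕ) :
    0 ≤ binomPMF m p j := by
  have : 0 ≤ 1 - p := by linarith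
  unfold binomPMF
  positivity

lemma binomPMF_sum (m : ℕ) (p : ℝ) : ∑ j ∈ Finset.range (m + 1), binomPMF m p j = 1 := by
  have h := add_pow p (1 - p) m
  rw [add_sub_cancel, one_pow] at h
  rw [h]
  refine Finset.sum_congr rfl fun j _ => ?_
  unfold binomPMF
  ring

lemma binomExp_mono (n : ℕ) (p : ℝ) (hp0 : 0 < p) (hp1 : p < 1) (h : ℕ → ℝ)
    (hh : ∀ a, a + 1 ≤ n → h a ≤ h (a + 1)) (x : ℕ) (hx : x + 1 ≤ n) :
    binomExp p h (n - x) x ≤ binomExp p h (n - (x + 1)) (x + 1) := by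
  obtain ⟨m, rfl⟩ := Nat.exists_eq_add_of_le hx
  rw [show x + 1 + m - x = m + 1 by omega, show x + 1 + m - (x + 1) = m by omega, binomExp_succ]
  have key : binomExp p h m x ≤ binomExp p h m (x + 1) := by
    refine Finset.sum_le_sum fun j hj => ?_
    rw [Finset.mem_range] at hj
    refine mul_le_mul_of_nonneg_left ?_ (binomPMF_nonneg m p hp0 hp1 j)
    rw [add_right_comm]
    exact hh _ (by omega)
  nlinarith

lemma stepProb_sum (n K : ℕ) (p : ℝ) (f : ℕ → ℝ) (x : ℕ) (hx : x ≤ n) :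
    ∑ z ∈ Finset.range (n + 1), stepProb n K p x z * f z =
      binomExp p (fun u => f (u - min u K)) (n - x) x := by
  unfold stepProb binomExp
  simp_rw [Finset.sum_mul]
  rw [Finset.sum_comm]
  refine Finset.sum_congr rfl fun j hj => ?_
  rw [Finset.mem_range] at hj
  simp_rw [ite_mul, zero_mul]
  rw [Finset.sum_ite_eq, if_pos]
  rw [Finset.mem_range]
  omega

/-- Tail probability from the starting state `x`. -/
noncomputable def tailProb (n K : ℕ) (p : ℝ) (k t x : ℕ) : ℝ :=
  ∑ y ∈ Finset.range (n + 1), if k ≤ y then iterProb n K p t x y else 0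

lemma tailProb_succ (n K : ℕ) (p : ℝ) (k t x : ℕ) (hx : x ≤ n) :
    tailProb n K p k (t + 1) x =
      binomExp p (fun u => tailProb n K p k t (u - min u K)) (n - x) x := by
  rw [← stepProb_sum n K p (tailProb n K p k t) x hx]
  unfold tailProb
  simp_rw [Finset.mul_sum]
  rw [Finset.sum_comm]
  refine Finset.sum_congr rfl fun y _ => ?_
  split_ifs with h
  · rfl
  · simp

lemma tailProb_mono (n K : ℕ) (p : ℝ) (hp0 : 0 < p) (hp1 : p < 1) (k t : ℕ) :
    ∀ x, x + 1 ≤ n → tailProb n K p k t x ≤ tailProb n K p k t (x + 1) := by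
  induction t with
  | zero =>
    have e : ∀ x ≤ n, tailProb n K p k 0 x = if k ≤ x then 1 else 0 := by
      intro x hx
      unfold tailProb iterProb
      rw [Finset.sum_eq_single x]
      · simp
      · intro b _ hb
        simp [hb.symm]
      · intro h
        exact absurd (Finset.mem_range.2 (by omega)) h
    intro x hx
    rw [e x (by omega), e _ hx]
    split_ifs <;> first | omega | norm_num
  | succ t ih =>
    intro x hx
    rw [tailProb_succ n K p k t x (by omega), tailProb_succ n K p k t _ hx]
    refine binomExp_mono n p hp0 hp1 _ ?_ x hx
    intro a ha
    rcases Nat.lt_or_ge a K with h | h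
    · rw [show a - min a K = a + 1 - min (a + 1) K by omega]
    · rw [show a + 1 - min (a + 1) K = (a - min a K) + 1 by omega]
      exact ih _ (by omega)

lemma tailProb_zero_le (n K : ℕ) (p : ℝ) (hp0 : 0 < p) (hp1 : p < 1) (k t : ℕ) :
    ∀ x ≤ n, tailProb n K p k t 0 ≤ tailProb n K p k t x := by
  intro x
  induction x with
  | zero => intro _; exact le_rfl
  | succ x ih =>
    intro hx
    exact (ih (by omega)).trans (tailProb_mono n K p hp0 hp1 k t x hx)

/-- For the error Markov chain started at `X₀ = 0`, the tail probabilities are nondecreasing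
in time: for every `k ∈ {0, ..., n}` and every `t ≥ 0`, `P[X_{t+1} ≥ k] ≥ P[X_t ≥ k]`. -/
theorem tail_prob_monotone_in_time (n K : ℕ) (hn : 0 < n) (p : ℝ) (hp0 : 0 < p) (hp1 : p < 1)
    (hK : K ≤ n) (k : ℕ) (hk : k ≤ n) (t : ℕ) :
    (∑ y ∈ Finset.range (n + 1), if k ≤ y then iterProb n K p t 0 y else 0) ≤
      ∑ y ∈ Finset.range (n + 1), if k ≤ y then iterProb n K p (t + 1) 0 y else 0 := by
  change tailProb n K p k t 0 ≤ tailProb n K p k (t + 1) 0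
  rw [tailProb_succ n K p k t 0 (Nat.zero_le n)]
  calc tailProb n K p k t 0
      = ∑ j ∈ Finset.range (n - 0 + 1), binomPMF (n - 0) p j * tailProb n K p k t 0 := by
        rw [← Finset.sum_mul, binomPMF_sum, one_mul]
    _ ≤ _ := by
        refine Finset.sum_le_sum fun j hj => ?_
        rw [Finset.mem_range] at hj
        exact mul_le_mul_of_nonneg_left
          (tailProb_zero_le n K p hp0 hp1 k t _ (by omega)) (binomPMF_nonneg _ p hp0 hp1 j)
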